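/- arXiv:2412.08379 — 2 statements merged into one kernel-verified Lean document; each statement's English description precedes it below -/
import Mathlib

section
/- Let 3 ≤ n ≤ N, θ_n ∈ [0,1/2], and α ∈ (0,1). Then for every 1 ≤ k ≤ n−2 one has ρ_k I_{n−k−1}^{(α)} ≥ I_{n−k}^{(α)}. -/
open Real MeasureTheory

/-- Graded mesh point `t_j = T (j/N)^r`. -/
noncomputable def gridT (T r : ℝ) (N j : ℕ) : ℝ := T * ((j : ℝ) / (N : ℝ)) ^ r

/-- Step size `τ_j = t_j - t_{j-1}`. -/
noncomputable def gridTau (T r : ℝ) (N j : ℕ) : ℝ := gridT T r N j - gridT T r N (j - 1)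

/-- Step-size ratio `ρ_j = τ_j / τ_{j+1}`. -/
noncomputable def gridRho (T r : ℝ) (N j : ℕ) : ℝ := gridTau T r N j / gridTau T r N (j + 1)

/-- Offset point `t_{n-θ} = θ t_{n-1} + (1-θ) t_n`. -/
noncomputable def tTheta (T r : ℝ) (N n : ℕ) (θ : ℝ) : ℝ :=
  θ * gridT T r N (n - 1) + (1 - θ) * gridT T r N n

/-- Coefficient `a_{n-k}^{(α)}`, parametrized by `k`. -/
noncomputable def coefA (T r : ℝ) (N n : ℕ) (θ α : ℝ) (k : ℕ) : ℝ :=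
  (1 / (gridTau T r N k * Real.Gamma (1 - α))) *
    ∫ s in (gridT T r N (k - 1))..(min (gridT T r N k) (tTheta T r N n θ)),
      (tTheta T r N n θ - s) ^ (-α)

/-- Coefficient `b_{n-k}^{(α)}`, parametrized by `k`. -/
noncomputable def coefB (T r : ℝ) (N n : ℕ) (θ α : ℝ) (k : ℕ) : ℝ :=
  (2 / (gridTau T r N k * (gridTau T r N k + gridTau T r N (k + 1)) * Real.Gamma (1 - α))) *
    ∫ s in (gridT T r N (k - 1))..(gridT T r N k),
      (s - (gridT T r N (k - 1) + gridT T r N k) / 2) * (tTheta T r N n θ - s) ^ (-α)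

/-- Coefficient `I_{n-k}^{(α)}`, parametrized by `k`. -/
noncomputable def coefI (T r : ℝ) (N n : ℕ) (θ α : ℝ) (k : ℕ) : ℝ :=
  (α / (Real.Gamma (1 - α) * gridTau T r N k)) *
    ∫ s in (gridT T r N (k - 1))..(gridT T r N k),
      (gridT T r N k - s) * (tTheta T r N n θ - s) ^ (-α - 1)

/-- Coefficient `J_{n-k}^{(α)}`, parametrized by `k`. -/
noncomputable def coefJ (T r : ℝ) (N n : ℕ) (θ α : ℝ) (k : ℕ) : ℝ :=
  (α / (Real.Gamma (1 - α) * gridTau T r N k)) *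
    ∫ s in (gridT T r N (k - 1))..(gridT T r N k),
      (s - gridT T r N (k - 1)) * (tTheta T r N n θ - s) ^ (-α - 1)

/-- Coefficient `c_{n-k,n}^{(α)}`, parametrized by `k` (`1 ≤ k ≤ n`). -/
noncomputable def coefC (T r : ℝ) (N n : ℕ) (θ α : ℝ) (k : ℕ) : ℝ :=
  if n = 1 then coefA T r N n θ α n
  else if k = n then coefA T r N n θ α n + gridRho T r N (n - 1) * coefB T r N n θ α (n - 1)
  else if k = 1 then coefA T r N n θ α 1 - coefB T r N n θ α 1
  else coefA T r N n θ α k + gridRho T r N (k - 1) * coefB T r N n θ α (k - 1)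
         - coefB T r N n θ α k

theorem gridT_lt_gridT {T r : ℝ} {N i j : ℕ} (hT : 0 < T) (hr : 0 < r) (hN : 0 < N)
    (hij : i < j) : gridT T r N i < gridT T r N j := by
  have hN' : (0 : ℝ) < N := by exact_mod_cast hN
  have hij' : (i : ℝ) < j := by exact_mod_cast hij
  unfold gridT
  gcongr

theorem gridTau_pos {T r : ℝ} {N j : ℕ} (hT : 0 < T) (hr : 0 < r) (hN : 0 < N) (hj : 0 < j) :
    0 < gridTau T r N j :=
  sub_pos.2 (gridT_lt_gridT hT hr hN (Nat.sub_lt hj one_pos))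

theorem gridT_lt_tTheta {T r : ℝ} {N n j : ℕ} {θ : ℝ} (hT : 0 < T) (hr : 0 < r) (hN : 0 < N)
    (hθ : θ < 1) (hj : j < n) : gridT T r N j < tTheta T r N n θ := by
  have h₁ : gridT T r N (n - 1) < gridT T r N n := gridT_lt_gridT hT hr hN (by omega)
  have h₂ : gridT T r N j ≤ gridT T r N (n - 1) := by
    rcases (Nat.le_sub_one_of_lt hj).eq_or_lt with h | h
    · rw [h]
    · exact (gridT_lt_gridT hT hr hN h).le
  unfold tTheta
  nlinarith

/-- The substitution `s = t_k - τ_k u` maps the integral defining `coefI` to `[0, 1]`. -/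
theorem coefI_eq_unit_integral {T r : ℝ} {N n k : ℕ} {θ α : ℝ} (hτ : gridTau T r N k ≠ 0) :
    coefI T r N n θ α k = α / Real.Gamma (1 - α) * gridTau T r N k *
      ∫ u in (0 : ℝ)..1, u * (tTheta T r N n θ - (gridT T r N k - gridTau T r N k * u)) ^
        (-α - 1) := by
  have hsub := intervalIntegral.integral_comp_sub_mul (a := 0) (b := 1)
    (fun s => (gridT T r N k - s) * (tTheta T r N n θ - s) ^ (-α - 1)) hτ (gridT T r N k)
  have hend : gridT T r N k - gridTau T r N k * 1 = gridT T r N (k - 1) := by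
    unfold gridTau; ring
  simp only [hend, mul_zero, sub_zero, sub_sub_cancel, mul_assoc,
    intervalIntegral.integral_const_mul, smul_eq_mul] at hsub
  rw [eq_inv_mul_iff_mul_eq₀ hτ] at hsub
  rw [coefI, ← hsub]
  field_simp

theorem continuousOn_unit_integrand {a t τ p : ℝ} (hat : t < a) (hτ : 0 ≤ τ) :
    ContinuousOn (fun u : ℝ => u * (a - (t - τ * u)) ^ p) (Set.Icc 0 1) := by
  refine continuousOn_id.mul (ContinuousOn.rpow_const (by fun_prop) fun u hu => Or.inl ?_)
  have := mul_nonneg hτ hu.1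
  linarith

/-- For `3 ≤ n ≤ N`, `θ ∈ [0,1/2]`, `α ∈ (0,1)` and `1 ≤ k ≤ n-2`, one has
`ρ_k I_{n-k-1}^{(α)} ≥ I_{n-k}^{(α)}`. -/
theorem coefI_ratio_mono (T r : ℝ) (N n : ℕ) (θ α : ℝ)
    (hT : 0 < T) (hr : 1 ≤ r) (hN : 1 ≤ N) (hn3 : 3 ≤ n) (hnN : n ≤ N)
    (hθ0 : 0 ≤ θ) (hθ : θ ≤ 1 / 2) (hα0 : 0 < α) (hα1 : α < 1) :
    ∀ k : ℕ, 1 ≤ k → k ≤ n - 2 →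
      coefI T r N n θ α k ≤ gridRho T r N k * coefI T r N n θ α (k + 1) := by
  intro k hk hkn
  have hr0 : 0 < r := by linarith
  have hτk : 0 < gridTau T r N k := gridTau_pos hT hr0 hN hk
  have hτk' : 0 < gridTau T r N (k + 1) := gridTau_pos hT hr0 hN k.succ_pos
  have htk : gridT T r N k < tTheta T r N n θ :=
    gridT_lt_tTheta hT hr0 hN (by linarith) (by omega)
  have htk' : gridT T r N (k + 1) < tTheta T r N n θ :=
    gridT_lt_tTheta hT hr0 hN (by linarith) (by omega)
  have hstep : gridTau T r N (k + 1) = gridT T r N (k + 1) - gridT T r N k := rfl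
  have hΓ : 0 < Real.Gamma (1 - α) := Real.Gamma_pos_of_pos (by linarith)
  have hrhs : ∀ x : ℝ, gridRho T r N k * (α / Real.Gamma (1 - α) * gridTau T r N (k + 1) * x) =
      α / Real.Gamma (1 - α) * gridTau T r N k * x := by
    intro x
    unfold gridRho
    field_simp
  rw [coefI_eq_unit_integral hτk.ne', coefI_eq_unit_integral hτk'.ne', hrhs]
  refine mul_le_mul_of_nonneg_left ?_ (by positivity)
  refine intervalIntegral.integral_mono_on zero_le_one
    ((continuousOn_unit_integrand htk hτk.le).intervalIntegrable_of_Icc zero_le_one)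
    ((continuousOn_unit_integrand htk' hτk'.le).intervalIntegrable_of_Icc zero_le_one) ?_
  intro u hu
  have h₁ := mul_nonneg hτk.le hu.1
  have h₂ := mul_nonneg hτk'.le hu.1
  have h₃ := mul_le_mul_of_nonneg_left hu.2 hτk'.le
  refine mul_le_mul_of_nonneg_left (Real.rpow_le_rpow_of_nonpos ?_ ?_ ?_) hu.1 <;> linarith
end

section
/- Let 1 ≤ n ≤ N, θ_n ∈ [0,1/2], and α ∈ [0,1). Then c_{0,n}^{(α)} ≤ (9/(8 τ_n)) ∫_{t_{n−1}}^{t_n} (t_n − s)^{−α}/Γ(1−α) ds = 9/(8 Γ(2−α) τ_n^{α}). -/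
open Real MeasureTheory

theorem gridT_strictMono {T r : ℝ} {N : ℕ} (hT : 0 < T) (hr : 0 < r) (hN : 1 ≤ N) :
    StrictMono (gridT T r N) := by
  intro i j hij
  have hN' : (0 : ℝ) < N := by exact_mod_cast hN
  have hij' : (i : ℝ) < j := by exact_mod_cast hij
  unfold gridT
  gcongr

theorem gridTau_le_succ {T r : ℝ} (N m : ℕ) (hT : 0 ≤ T) (hr : 1 ≤ r) :
    gridTau T r N (m + 1) ≤ gridTau T r N (m + 2) := by
  have h := (convexOn_rpow hr).2 (Set.mem_Ici.2 (by positivity : 0 ≤ (m : ℝ) / N))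
    (Set.mem_Ici.2 (by positivity : 0 ≤ ((m + 2 : ℕ) : ℝ) / N))
    one_half_pos.le one_half_pos.le (add_halves 1)
  have hmid : (1 / 2 : ℝ) • ((m : ℝ) / N) + (1 / 2 : ℝ) • (((m + 2 : ℕ) : ℝ) / N)
      = ((m + 1 : ℕ) : ℝ) / N := by
    simp only [smul_eq_mul]; push_cast; ring
  rw [hmid] at h
  simp only [smul_eq_mul] at h
  have h' := mul_le_mul_of_nonneg_left h hT
  simp only [gridTau, gridT, Nat.add_sub_cancel, show m + 2 - 1 = m + 1 from rfl]
  linarith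

theorem integral_sub_rpow_neg {α : ℝ} (hα : α < 1) (a c : ℝ) :
    ∫ s in a..c, (c - s) ^ (-α) = (c - a) ^ (1 - α) / (1 - α) := by
  have h1 : 1 - α ≠ 0 := by linarith
  rw [intervalIntegral.integral_comp_sub_left (fun x : ℝ => x ^ (-α)) c,
    integral_rpow (Or.inl (by linarith)), sub_self, neg_add_eq_sub, Real.zero_rpow h1, sub_zero]

/-- The first moment about the midpoint of the kernel `(c - s) ^ (-α)` is controlled by the
largest value of the kernel. -/
theorem integral_sub_midpoint_mul_rpow_neg_le {a b c α : ℝ} (hab : a ≤ b) (hbc : b < c)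
    (hα : 0 ≤ α) :
    ∫ s in a..b, (s - (a + b) / 2) * (c - s) ^ (-α) ≤ (b - a) ^ 2 / 8 * (c - b) ^ (-α) := by
  have hcont : ContinuousOn (fun s : ℝ => (s - (a + b) / 2) * (c - s) ^ (-α)) (Set.Iic b) := by
    refine ContinuousOn.mul (by fun_prop) (ContinuousOn.rpow_const (by fun_prop) ?_)
    intro s hs
    exact Or.inl (sub_pos.2 (lt_of_le_of_lt hs hbc)).ne'
  have ham : a ≤ (a + b) / 2 := by linarith
  have hmb : (a + b) / 2 ≤ b := by linarith
  have hint : ∀ x y : ℝ, x ≤ y → y ≤ b → IntervalIntegrable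
      (fun s : ℝ => (s - (a + b) / 2) * (c - s) ^ (-α)) volume x y := fun x y hxy hy =>
    (hcont.mono (by rw [Set.uIcc_of_le hxy]; exact fun s hs => hs.2.trans hy)).intervalIntegrable
  rw [← intervalIntegral.integral_add_adjacent_intervals (hint _ _ ham hmb) (hint _ _ hmb le_rfl)]
  have hleft : ∫ s in a..(a + b) / 2, (s - (a + b) / 2) * (c - s) ^ (-α) ≤ 0 := by
    rw [← neg_nonneg, ← intervalIntegral.integral_neg]
    refine intervalIntegral.integral_nonneg ham fun s hs => neg_nonneg.2 ?_
    exact mul_nonpos_of_nonpos_of_nonneg (by linarith [hs.2])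
      (Real.rpow_nonneg (by linarith [hs.2]) _)
  have hright : ∫ s in (a + b) / 2..b, (s - (a + b) / 2) * (c - s) ^ (-α)
      ≤ ∫ s in (a + b) / 2..b, (s - (a + b) / 2) * (c - b) ^ (-α) := by
    refine intervalIntegral.integral_mono_on hmb (hint _ _ hmb le_rfl)
      (Continuous.intervalIntegrable (by fun_prop) _ _) fun s hs => ?_
    exact mul_le_mul_of_nonneg_left
      (Real.rpow_le_rpow_of_nonpos (by linarith) (by linarith [hs.2]) (by linarith))
      (by linarith [hs.1])
  have hval : ∫ s in (a + b) / 2..b, (s - (a + b) / 2) * (c - b) ^ (-α)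
      = (b - a) ^ 2 / 8 * (c - b) ^ (-α) := by
    rw [intervalIntegral.integral_mul_const,
      intervalIntegral.integral_comp_sub_right (fun x : ℝ => x), integral_id]
    ring
  linarith

theorem rpow_add_mul_rpow_neg_le {x α : ℝ} (hx : 1 / 2 ≤ x) (hx1 : x ≤ 1)
    (hα0 : 0 ≤ α) (hα1 : α ≤ 1) :
    x ^ (1 - α) + (1 - α) / 8 * x ^ (-α) ≤ 9 / 8 := by
  have hx0 : 0 < x := by linarith
  have h1 : x ^ (1 - α) ≤ 1 + (1 - α) * (x - 1) := by
    simpa using rpow_one_add_le_one_add_mul_self (s := x - 1) (by linarith)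
      (p := 1 - α) (by linarith) (by linarith)
  have h2 : x ^ (-α) ≤ 1 + 2 * (1 - x) := by
    have h3 : x ^ (-α) ≤ x ^ (-1 : ℝ) := Real.rpow_le_rpow_of_exponent_ge hx0 hx1 (by linarith)
    refine h3.trans ?_
    rw [Real.rpow_neg_one, inv_le_iff_one_le_mul₀ hx0]
    nlinarith
  have h4 := mul_le_mul_of_nonneg_left h2 (show 0 ≤ (1 - α) / 8 by linarith)
  nlinarith [mul_nonneg (sub_nonneg.2 hα1) (sub_nonneg.2 hx1)]

theorem tTheta_sub_gridT_pred (T r : ℝ) (N n : ℕ) (θ : ℝ) :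
    tTheta T r N n θ - gridT T r N (n - 1) = (1 - θ) * gridTau T r N n := by
  unfold tTheta gridTau; ring

theorem coefA_self {T r θ α : ℝ} {N n : ℕ} (hτ : 0 ≤ gridTau T r N n)
    (hθ0 : 0 ≤ θ) (hα : α < 1) :
    coefA T r N n θ α n = 1 / (gridTau T r N n * Real.Gamma (1 - α)) *
      (((1 - θ) * gridTau T r N n) ^ (1 - α) / (1 - α)) := by
  have hle : tTheta T r N n θ ≤ gridT T r N n := by
    have h := mul_nonneg hθ0 hτ
    unfold gridTau at h
    unfold tTheta
    linarith
  rw [coefA, min_eq_right hle, integral_sub_rpow_neg hα, tTheta_sub_gridT_pred]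

theorem gridRho_mul_coefB_le {T r θ α : ℝ} {N m : ℕ} (hT : 0 < T) (hr : 1 ≤ r) (hN : 1 ≤ N)
    (hθ : θ < 1) (hα0 : 0 ≤ α) (hα1 : α < 1) :
    gridRho T r N (m + 1) * coefB T r N (m + 2) θ α (m + 1) ≤
      1 / (gridTau T r N (m + 2) * Real.Gamma (1 - α)) *
        (gridTau T r N (m + 2) / 8 * ((1 - θ) * gridTau T r N (m + 2)) ^ (-α)) := by
  have hmono := gridT_strictMono hT (zero_lt_one.trans_le hr) hN
  have hσ : 0 < gridTau T r N (m + 1) := sub_pos.2 (hmono (by simp))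
  have hle := gridTau_le_succ N m hT.le hr
  have hτ := hσ.trans_le hle
  have hG : 0 < Real.Gamma (1 - α) := Real.Gamma_pos_of_pos (by linarith)
  have hsub := tTheta_sub_gridT_pred T r N (m + 2) θ
  rw [show m + 2 - 1 = m + 1 from rfl] at hsub
  have hd : 0 < (1 - θ) * gridTau T r N (m + 2) := mul_pos (by linarith) hτ
  have hI := integral_sub_midpoint_mul_rpow_neg_le (a := gridT T r N (m + 1 - 1))
    (b := gridT T r N (m + 1)) (c := tTheta T r N (m + 2) θ) (α := α)
    (hmono.monotone (by simp)) (by linarith) hα0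
  rw [hsub, ← gridTau] at hI
  rw [gridRho, coefB, show m + 1 + 1 = m + 2 from rfl]
  have hP := Real.rpow_nonneg hd.le (-α)
  generalize ∫ s in gridT T r N (m + 1 - 1)..gridT T r N (m + 1),
    (s - (gridT T r N (m + 1 - 1) + gridT T r N (m + 1)) / 2) *
      (tTheta T r N (m + 2) θ - s) ^ (-α) = J at *
  generalize gridTau T r N (m + 1) = σ at *
  generalize ((1 - θ) * gridTau T r N (m + 2)) ^ (-α) = P at *
  generalize gridTau T r N (m + 2) = τ at *
  generalize Real.Gamma (1 - α) = G at *
  calc _ = 1 / (τ * G) * (2 / (σ + τ) * J) := by field_simp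
    _ ≤ 1 / (τ * G) * (2 / (σ + τ) * (σ ^ 2 / 8 * P)) := by gcongr
    _ = 1 / (τ * G) * (σ ^ 2 / (4 * (σ + τ)) * P) := by field_simp; ring
    _ ≤ 1 / (τ * G) * (τ / 8 * P) := by
      gcongr 1 / (τ * G) * (?_ * P)
      rw [div_le_div_iff₀ (by positivity) (by norm_num)]
      nlinarith

theorem coefC_self_le {T r θ α : ℝ} {N n : ℕ} (hT : 0 < T) (hr : 1 ≤ r) (hN : 1 ≤ N)
    (hn : 1 ≤ n) (hθ0 : 0 ≤ θ) (hθ : θ < 1) (hα0 : 0 ≤ α) (hα1 : α < 1) :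
    coefC T r N n θ α n ≤ 1 / (gridTau T r N n * Real.Gamma (1 - α)) *
      (((1 - θ) * gridTau T r N n) ^ (1 - α) / (1 - α) +
        gridTau T r N n / 8 * ((1 - θ) * gridTau T r N n) ^ (-α)) := by
  have hτ : 0 < gridTau T r N n :=
    sub_pos.2 (gridT_strictMono hT (zero_lt_one.trans_le hr) hN (by omega))
  have hG : 0 < Real.Gamma (1 - α) := Real.Gamma_pos_of_pos (by linarith)
  have hP := Real.rpow_nonneg (mul_nonneg (sub_nonneg.2 hθ.le) hτ.le) (-α)
  rw [mul_add, ← coefA_self hτ.le hθ0 hα1]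
  match n, hn with
  | 1, _ =>
    rw [coefC, if_pos rfl]
    exact le_add_of_nonneg_right (by positivity)
  | m + 2, _ =>
    rw [coefC, if_neg (by omega), if_pos rfl]
    exact add_le_add_right (gridRho_mul_coefB_le hT hr hN hθ hα0 hα1) _

/-- For `1 ≤ n ≤ N`, `θ ∈ [0,1/2]`, `α ∈ [0,1)`:
`c_{0,n}^{(α)} ≤ (9/(8τ_n)) ∫_{t_{n-1}}^{t_n} (t_n-s)^{-α}/Γ(1-α) ds = 9/(8 Γ(2-α) τ_n^α)`. -/
theorem coefC_zero_upper (T r : ℝ) (N n : ℕ) (θ α : ℝ)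
    (hT : 0 < T) (hr : 1 ≤ r) (hN : 1 ≤ N) (hn1 : 1 ≤ n) (hnN : n ≤ N)
    (hθ0 : 0 ≤ θ) (hθ : θ ≤ 1 / 2) (hα0 : 0 ≤ α) (hα1 : α < 1) :
    coefC T r N n θ α n ≤
      (9 / (8 * gridTau T r N n)) *
        ∫ s in (gridT T r N (n - 1))..(gridT T r N n),
          (gridT T r N n - s) ^ (-α) / Real.Gamma (1 - α) ∧
    (9 / (8 * gridTau T r N n)) *
        (∫ s in (gridT T r N (n - 1))..(gridT T r N n),
          (gridT T r N n - s) ^ (-α) / Real.Gamma (1 - α)) =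
      9 / (8 * Real.Gamma (2 - α) * gridTau T r N n ^ α) := by
  have hτ : 0 < gridTau T r N n :=
    sub_pos.2 (gridT_strictMono hT (zero_lt_one.trans_le hr) hN (by omega))
  have hG : 0 < Real.Gamma (1 - α) := Real.Gamma_pos_of_pos (by linarith)
  have hβ : 0 < 1 - α := by linarith
  have hC := coefC_self_le hT hr hN hn1 hθ0 (hθ.trans_lt one_half_lt_one) hα0 hα1
  have hx := rpow_add_mul_rpow_neg_le (x := 1 - θ) (by linarith) (by linarith) hα0 hα1.le
  rw [intervalIntegral.integral_div, integral_sub_rpow_neg hα1, ← gridTau]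
  have hτα : gridTau T r N n ^ (1 - α) = gridTau T r N n * gridTau T r N n ^ (-α) := by
    rw [sub_eq_add_neg, Real.rpow_add hτ, Real.rpow_one]
  constructor
  · refine hC.trans ?_
    have hθ' : 0 ≤ 1 - θ := by linarith
    rw [Real.mul_rpow hθ' hτ.le, Real.mul_rpow hθ' hτ.le, hτα]
    have hP := Real.rpow_pos_of_pos hτ (-α)
    generalize gridTau T r N n ^ (-α) = P at *
    generalize gridTau T r N n = τ at *
    generalize Real.Gamma (1 - α) = G at *
    calc _ = P / (G * (1 - α)) * ((1 - θ) ^ (1 - α) + (1 - α) / 8 * (1 - θ) ^ (-α)) := by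
          field_simp
      _ ≤ P / (G * (1 - α)) * (9 / 8) := by gcongr
      _ = _ := by field_simp
  · have hΓ : Real.Gamma (2 - α) = (1 - α) * Real.Gamma (1 - α) := by
      rw [← Real.Gamma_add_one hβ.ne']; congr 1; ring
    rw [hΓ, hτα, Real.rpow_neg hτ.le]
    have hP := Real.rpow_pos_of_pos hτ α
    field_simp
end
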